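/- Let X be a metric space and b ≥ 1 a natural number such that for every x ∈ X and every ρ > 0, the closed ball of radius ρ around x can be covered by at most b closed balls of radius ρ/2. Let x ∈ X, let ρ ≥ 1 be a real number, and let S ⊆ X be a finite set of points, pairwise at distance greater than 1 from each other, all contained in the closed ball of radius ρ around x. Then |S| ≤ b^{⌈log₂ ρ⌉ + 1}. -/

import Mathlib

open Metric Finset

theorem sep_card_aux {X : Type*} [MetricSpace X] (b : ℕ)
    (hdoubling : ∀ (x : X) (ρ : ℝ), 0 < ρ → ∃ t : Finset X,
      t.card ≤ b ∧ closedBall x ρ ⊆ ⋃ y ∈ t, closedBall y (ρ / 2)) (n : ℕ) :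
    ∀ (x : X) (r : ℝ), 0 < r → r ≤ 2 ^ n / 2 → ∀ S : Finset X,
    (∀ u ∈ S, ∀ w ∈ S, u ≠ w → 1 < dist u w) →
    (∀ u ∈ S, u ∈ closedBall x r) → S.card ≤ b ^ n := by
  classical
  induction n with
  | zero =>
    intro x r hr hr2 S hsep hball
    rw [pow_zero, Finset.card_le_one]
    intro u hu w hw
    by_contra hne
    have h1 := hsep u hu w hw hne
    have h2 := mem_closedBall.1 (hball u hu)
    have h3 := mem_closedBall.1 (hball w hw)
    have h4 := dist_triangle_right u w x
    norm_num at hr2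
    linarith
  | succ n ih =>
    intro x r hr hr2 S hsep hball
    obtain ⟨t, ht, hcov⟩ := hdoubling x r hr
    have hsub : S ⊆ t.biUnion (fun y => S.filter (fun u => u ∈ closedBall y (r / 2))) := by
      intro u hu
      have h := hcov (hball u hu)
      simp only [Set.mem_iUnion] at h
      obtain ⟨y, hy, huy⟩ := h
      exact Finset.mem_biUnion.2 ⟨y, hy, Finset.mem_filter.2 ⟨hu, huy⟩⟩
    calc S.card ≤ _ := Finset.card_le_card hsub
      _ ≤ t.card * b ^ n := by
        apply Finset.card_biUnion_le_card_mul
        intro y hy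
        apply ih y (r / 2) (by linarith) (by rw [pow_succ] at hr2; linarith)
        · intro u hu w hw
          exact hsep u (Finset.mem_filter.1 hu).1 w (Finset.mem_filter.1 hw).1
        · intro u hu
          exact (Finset.mem_filter.1 hu).2
      _ ≤ b * b ^ n := Nat.mul_le_mul_right _ ht
      _ = b ^ (n + 1) := by ring

/-- Growth-boundedness of unit ball graphs over doubling metric spaces: a set of
points pairwise at distance more than `1`, contained in a closed ball of radius
`ρ ≥ 1`, has size at most `b^(⌈log₂ ρ⌉ + 1)` where `b` is the doubling
constant. -/
theorem stmt_12 {X : Type*} [MetricSpace X] (b : ℕ) (hb : 1 ≤ b)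
    (hdoubling : ∀ (x : X) (ρ : ℝ), 0 < ρ → ∃ t : Finset X,
      t.card ≤ b ∧ closedBall x ρ ⊆ ⋃ y ∈ t, closedBall y (ρ / 2))
    (x : X) (ρ : ℝ) (hρ : 1 ≤ ρ) (S : Finset X)
    (hSsep : ∀ u ∈ S, ∀ w ∈ S, u ≠ w → 1 < dist u w)
    (hSball : ∀ u ∈ S, u ∈ closedBall x ρ) :
    S.card ≤ b ^ (⌈Real.logb 2 ρ⌉₊ + 1) := by
  refine sep_card_aux b hdoubling _ x ρ (by linarith) ?_ S hSsep hSball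
  have h1 : Real.logb 2 ρ ≤ (⌈Real.logb 2 ρ⌉₊ : ℝ) := Nat.le_ceil _
  have h2 := (Real.logb_le_iff_le_rpow (by norm_num) (by linarith)).1 h1
  rw [Real.rpow_natCast] at h2
  rw [pow_succ]
  linarith
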